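/- Fix a real number κ and a real x₀ > 0, and suppose F : ℂ → ℂ is an entire function such that F(μ) = W_{κ,μ}(x₀) for every complex μ with 2μ not an integer. Then the set of real zeros {μ ∈ ℝ : F(μ) = 0} is finite; it is empty when κ ≤ 0, and when κ > 0 it is contained in the open interval (−κ, κ). -/

import Mathlib

/-- The Whittaker M-function `M_{κ,μ}(x)` for real `x > 0`, defined by its series. -/
noncomputable def whittakerM (κ μ : ℂ) (x : ℝ) : ℂ :=
  Complex.exp (-(x:ℂ)/2) * Complex.exp ((1/2 + μ) * (Real.log x : ℂ)) *
    ∑' j : ℕ, (Polynomial.eval (1/2 - κ + μ) (ascPochhammer ℂ j)) /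
      ((Polynomial.eval (2*μ + 1) (ascPochhammer ℂ j)) * (Nat.factorial j : ℂ)) * (x:ℂ)^j

/-- The Whittaker W-function `W_{κ,μ}(x)` for real `x > 0` and `2μ` not an integer. -/
noncomputable def whittakerW (κ μ : ℂ) (x : ℝ) : ℂ :=
  Complex.Gamma (-(2*μ)) / Complex.Gamma (1/2 - κ - μ) * whittakerM κ μ x +
  Complex.Gamma (2*μ) / Complex.Gamma (1/2 - κ + μ) * whittakerM κ (-μ) x

open Real Set Filter Topology MeasureTheory

/-- Coefficients of the Kummer series. -/
noncomputable def kcf (a b : ℝ) (n : ℕ) : ℝ :=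
  (ascPochhammer ℝ n).eval a / ((ascPochhammer ℝ n).eval b * (n.factorial : ℝ))

/-- The (real) Kummer function. -/
noncomputable def kM (a b x : ℝ) : ℝ := ∑' n : ℕ, kcf a b n * x ^ n

lemma poch_ne {b : ℝ} (hb : ∀ n : ℕ, b + n ≠ 0) (n : ℕ) : (ascPochhammer ℝ n).eval b ≠ 0 := by
  induction n with
  | zero => simp
  | succ n ih => rw [ascPochhammer_succ_eval]; exact mul_ne_zero ih (hb n)

lemma poch_left (a : ℝ) (n : ℕ) :
    (ascPochhammer ℝ (n + 1)).eval a = a * (ascPochhammer ℝ n).eval (a + 1) := by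
  rw [ascPochhammer_succ_left]; simp [Polynomial.eval_comp]

lemma hb_succ {b : ℝ} (hb : ∀ n : ℕ, b + n ≠ 0) : ∀ n : ℕ, b + 1 + n ≠ 0 := by
  intro n h; apply hb (n + 1); push_cast; linarith

lemma hb_zero {b : ℝ} (hb : ∀ n : ℕ, b + n ≠ 0) : b ≠ 0 := by simpa using hb 0

lemma kcf_zero (a b : ℝ) : kcf a b 0 = 1 := by simp [kcf]

lemma kcf_succ {a b : ℝ} (hb : ∀ n : ℕ, b + n ≠ 0) (n : ℕ) :
    kcf a b (n + 1) = kcf a b n * ((a + n) / ((b + n) * (n + 1))) := by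
  have h1 := poch_ne hb n
  have h2 := hb n
  have h3 : (n.factorial : ℝ) ≠ 0 := by exact_mod_cast n.factorial_ne_zero
  have h4 : (n : ℝ) + 1 ≠ 0 := by positivity
  unfold kcf
  rw [ascPochhammer_succ_eval, ascPochhammer_succ_eval, Nat.factorial_succ]
  push_cast
  field_simp

lemma kcf_succ' {a b : ℝ} (hb : ∀ n : ℕ, b + n ≠ 0) (n : ℕ) :
    ((n : ℝ) + 1) * kcf a b (n + 1) = a / b * kcf (a + 1) (b + 1) n := by
  have h1 := poch_ne (hb_succ hb) n
  have h2 := hb_zero hb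
  have h3 : (n.factorial : ℝ) ≠ 0 := by exact_mod_cast n.factorial_ne_zero
  have h4 : (n : ℝ) + 1 ≠ 0 := by positivity
  unfold kcf
  rw [poch_left, poch_left, Nat.factorial_succ]
  push_cast
  field_simp

lemma kcf_B {a b : ℝ} (hb : ∀ n : ℕ, b + n ≠ 0) (n : ℕ) :
    kcf a b n - a / b * kcf (a + 1) (b + 1) n = (b - a) / b * kcf a (b + 1) n := by
  have h1 := poch_ne (hb_succ hb) n
  have h1' := poch_ne hb n
  have h2 := hb_zero hb
  have h5 := hb n
  have h3 : (n.factorial : ℝ) ≠ 0 := by exact_mod_cast n.factorial_ne_zero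
  have e1 : a * (ascPochhammer ℝ n).eval (a + 1) = (ascPochhammer ℝ n).eval a * (a + n) := by
    rw [← poch_left, ascPochhammer_succ_eval]
  have e2 : (ascPochhammer ℝ n).eval (b + 1) = (ascPochhammer ℝ n).eval b * (b + n) / b := by
    rw [← ascPochhammer_succ_eval, poch_left]; field_simp
  unfold kcf
  have : a / b * ((ascPochhammer ℝ n).eval (a + 1) /
      ((ascPochhammer ℝ n).eval (b + 1) * (n.factorial : ℝ))) =
      (a * (ascPochhammer ℝ n).eval (a + 1)) /
      (b * (ascPochhammer ℝ n).eval (b + 1) * (n.factorial : ℝ)) := by field_simp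
  rw [this, e1, e2]
  field_simp
  ring

lemma kcf_C {a b : ℝ} (hb : ∀ n : ℕ, b + n ≠ 0) (n : ℕ) :
    (b + n + 1) * kcf (a + 1) (b + 1) (n + 1) - kcf (a + 1) (b + 1) n = b * kcf a b (n + 1) := by
  have h4 : (n : ℝ) + 1 ≠ 0 := by positivity
  have h5 := hb_succ hb n
  have h6 := hb_zero hb
  have e := kcf_succ' (a := a) hb n
  have e' : kcf a b (n + 1) = a / b * kcf (a + 1) (b + 1) n / (n + 1) := by
    rw [← e]; field_simp
  rw [e', kcf_succ (hb_succ hb) n]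
  have : b + n + 1 ≠ 0 := by intro h; apply h5; linarith
  field_simp
  ring

lemma kcf_bound {a b : ℝ} (hb : ∀ n : ℕ, b + n ≠ 0) :
    ∃ C : ℝ, 0 ≤ C ∧ ∀ n : ℕ, |kcf a b n| ≤ C ^ n / (n.factorial : ℝ) := by
  have ht : Tendsto (fun n : ℕ => (a + n) / (b + n)) atTop (𝓝 1) := by
    have h1 : Tendsto (fun n : ℕ => b + (n : ℝ)) atTop atTop :=
      tendsto_atTop_add_const_left _ _ tendsto_natCast_atTop_atTop
    have h2 : Tendsto (fun n : ℕ => 1 + (a - b) / (b + (n : ℝ))) atTop (𝓝 (1 + 0)) :=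
      tendsto_const_nhds.add (h1.const_div_atTop _)
    rw [add_zero] at h2
    refine h2.congr fun n => ?_
    have := hb n
    field_simp
    ring
  obtain ⟨C, hC⟩ := (ht.norm.bddAbove_range)
  have hC' : ∀ n : ℕ, |(a + n) / (b + n)| ≤ C := fun n => hC ⟨n, rfl⟩
  have hC0 : 0 ≤ C := (abs_nonneg _).trans (hC' 0)
  refine ⟨C, hC0, fun n => ?_⟩
  induction n with
  | zero => simp [kcf_zero]
  | succ n ih =>
    have h4 : (0 : ℝ) < (n : ℝ) + 1 := by positivity
    have h3 : (0 : ℝ) < (n.factorial : ℝ) := by exact_mod_cast n.factorial_pos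
    rw [kcf_succ hb, abs_mul, Nat.factorial_succ]
    have : |(a + n) / ((b + n) * (n + 1))| = |(a + n) / (b + n)| / (n + 1) := by
      rw [← div_div, abs_div _ ((n : ℝ) + 1), abs_of_pos h4]
    rw [this]
    calc _ ≤ (C ^ n / (n.factorial : ℝ)) * (C / (n + 1)) := by
          gcongr
          exact hC' n
      _ = _ := by push_cast; rw [pow_succ]; field_simp

lemma kcf_summable {a b : ℝ} (hb : ∀ n : ℕ, b + n ≠ 0) (x : ℝ) :
    Summable fun n => kcf a b n * x ^ n := by
  obtain ⟨C, hC0, hC⟩ := kcf_bound (a := a) hb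
  refine Summable.of_norm_bounded (Real.summable_pow_div_factorial (C * |x|)) fun n => ?_
  rw [norm_mul, norm_pow, Real.norm_eq_abs, Real.norm_eq_abs, mul_pow]
  calc _ ≤ (C ^ n / (n.factorial : ℝ)) * |x| ^ n := by gcongr; exact hC n
    _ = _ := by ring

lemma kM_split {a b : ℝ} (hb : ∀ n : ℕ, b + n ≠ 0) (x : ℝ) :
    kM a b x = 1 + x * ∑' n : ℕ, kcf a b (n + 1) * x ^ n := by
  unfold kM
  rw [(kcf_summable hb x).tsum_eq_zero_add, ← tsum_mul_left]
  simp only [kcf_zero, pow_zero, mul_one]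
  congr 1
  apply tsum_congr; intro n; ring

lemma kM_hasDerivAt {a b : ℝ} (hb : ∀ n : ℕ, b + n ≠ 0) (x : ℝ) :
    HasDerivAt (kM a b) (a / b * kM (a + 1) (b + 1) x) x := by
  have hs := kcf_summable (a := a + 1) (hb_succ hb)
  obtain ⟨C, hC0, hC⟩ := kcf_bound (a := a + 1) (hb_succ hb)
  set R := |x| + 1
  have hR : 0 < R := by positivity
  have hu : Summable fun n : ℕ => |kcf a b n * n| * R ^ (n - 1) := by
    rw [← summable_nat_add_iff 1]
    refine (((kcf_summable (a := a + 1) (hb_succ hb) R).abs).mul_left |a / b|).congr fun n => ?_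
    have := kcf_succ' (a := a) hb n
    push_cast
    rw [mul_comm (kcf a b (n + 1)), this, abs_mul (kcf (a + 1) (b + 1) n),
      abs_mul (a / b), abs_of_pos (pow_pos hR n)]
    ring
  have key := hasDerivAt_tsum_of_isPreconnected (g := fun n y => kcf a b n * y ^ n)
    (g' := fun n y => kcf a b n * (n * y ^ (n - 1))) (y₀ := x) (y := x) hu
    (Metric.isOpen_ball (x := (0 : ℝ)) (ε := R))
    ((convex_ball (0 : ℝ) R).isPreconnected)
    (fun n y _ => (hasDerivAt_pow n y).const_mul _)
    (fun n y hy => by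
      rw [← mul_assoc, norm_mul, Real.norm_eq_abs, norm_pow]
      have : ‖y‖ ≤ R := by simpa using (mem_ball_zero_iff.1 hy).le
      gcongr)
    (by simp [R]) (kcf_summable hb x) (by simp [R])
  have hsum : Summable fun n : ℕ => kcf a b n * (n * x ^ (n - 1)) := by
    refine Summable.of_norm_bounded hu fun n => ?_
    rw [← mul_assoc, norm_mul, Real.norm_eq_abs, norm_pow]
    have : ‖x‖ ≤ R := by simp [R]
    gcongr
  suffices hh : ∑' n : ℕ, kcf a b n * (n * x ^ (n - 1)) = a / b * kM (a + 1) (b + 1) x by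
    rw [← hh]; exact key
  rw [hsum.tsum_eq_zero_add]
  simp only [Nat.cast_zero, zero_mul, mul_zero, zero_add]
  unfold kM
  rw [← tsum_mul_left]
  apply tsum_congr; intro n
  rw [← mul_assoc (a / b), ← kcf_succ' hb]
  rw [Nat.add_sub_cancel]
  push_cast
  ring

lemma kM_B {a b : ℝ} (hb : ∀ n : ℕ, b + n ≠ 0) (x : ℝ) :
    kM a b x - a / b * kM (a + 1) (b + 1) x = (b - a) / b * kM a (b + 1) x := by
  unfold kM
  rw [← tsum_mul_left, ← tsum_mul_left, ← (kcf_summable hb x).tsum_sub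
    ((kcf_summable (hb_succ hb) x).mul_left _)]
  apply tsum_congr; intro n
  rw [← mul_assoc, ← mul_assoc, ← kcf_B hb]; ring

lemma kM_C {a b : ℝ} (hb : ∀ n : ℕ, b + n ≠ 0) (x : ℝ) :
    (b - x) * kM (a + 1) (b + 1) x +
      x * ((a + 1) / (b + 1) * kM (a + 1 + 1) (b + 1 + 1) x) = b * kM a b x := by
  have hd : (a + 1) / (b + 1) * kM (a + 1 + 1) (b + 1 + 1) x =
      ∑' n : ℕ, ((n : ℝ) + 1) * kcf (a + 1) (b + 1) (n + 1) * x ^ n := by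
    unfold kM
    rw [← tsum_mul_left]
    apply tsum_congr; intro n
    rw [kcf_succ' (hb_succ hb)]; ring
  have s1 : Summable fun n : ℕ => ((n : ℝ) + 1) * kcf (a + 1) (b + 1) (n + 1) * x ^ n := by
    refine ((kcf_summable (a := a + 1 + 1) (hb_succ (hb_succ hb)) x).mul_left
      ((a + 1) / (b + 1))).congr fun n => ?_
    rw [kcf_succ' (hb_succ hb)]; ring
  have s2 := kcf_summable (a := a + 1) (hb_succ hb) x
  have s3 : Summable fun n : ℕ => kcf (a + 1) (b + 1) (n + 1) * x ^ n := by
    refine Summable.of_norm_bounded s1.norm fun n => ?_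
    rw [norm_mul, norm_mul, norm_mul]
    have : 1 ≤ ‖(n : ℝ) + 1‖ := by
      rw [Real.norm_of_nonneg (by positivity)]
      have : (0 : ℝ) ≤ n := by positivity
      linarith
    gcongr
    exact le_mul_of_one_le_left (norm_nonneg _) this
  have e : b * ∑' n : ℕ, kcf a b (n + 1) * x ^ n =
      b * ∑' n : ℕ, kcf (a + 1) (b + 1) (n + 1) * x ^ n - kM (a + 1) (b + 1) x +
      ∑' n : ℕ, ((n : ℝ) + 1) * kcf (a + 1) (b + 1) (n + 1) * x ^ n := by
    unfold kM
    rw [← tsum_mul_left, ← tsum_mul_left, ← (s3.mul_left b).tsum_sub s2,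
      ← ((s3.mul_left b).sub s2).tsum_add s1]
    apply tsum_congr; intro n
    rw [← mul_assoc, ← kcf_C hb]; ring
  rw [hd, kM_split hb, mul_add, mul_left_comm b x, e, sub_mul]
  rw [show b * kM (a + 1) (b + 1) x = b * (1 + x * ∑' n : ℕ, kcf (a + 1) (b + 1) (n + 1) * x ^ n)
    from by rw [kM_split (hb_succ hb)]]
  ring

lemma kM_zero {a b : ℝ} (hb : ∀ n : ℕ, b + n ≠ 0) : kM a b 0 = 1 := by
  rw [kM_split hb]; simp

lemma kM_pos {a b x : ℝ} (ha : 0 < a) (hb : 0 < b) (hx : 0 ≤ x) : 0 < kM a b x := by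
  have hb' : ∀ n : ℕ, b + n ≠ 0 := fun n => by positivity
  have hc : ∀ n : ℕ, 0 ≤ kcf a b n := by
    intro n
    induction n with
    | zero => simp [kcf_zero]
    | succ n ih => rw [kcf_succ hb']; positivity
  rw [kM_split hb']
  have : 0 ≤ ∑' n : ℕ, kcf a b (n + 1) * x ^ n :=
    tsum_nonneg fun n => mul_nonneg (hc _) (by positivity)
  positivity

/-- The integrand of the Laplace-type representation. -/
noncomputable def kg (a b x t : ℝ) : ℝ := exp (-x * t) * t ^ (a - 1) * (1 + t) ^ (b - a - 1)

/-- The Laplace-type integral. -/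
noncomputable def kI (a b x : ℝ) : ℝ := ∫ t in Ioi (0 : ℝ), kg a b x t

lemma kg_meas (a b x : ℝ) : AEStronglyMeasurable (kg a b x) (volume.restrict (Ioi 0)) := by
  have : Measurable (kg a b x) := by unfold kg; fun_prop
  exact this.aestronglyMeasurable

lemma kg_pos (a b x : ℝ) {t : ℝ} (ht : 0 < t) : 0 < kg a b x t := by
  unfold kg; positivity

lemma kg_int {a x : ℝ} (b : ℝ) (ha : 0 < a) (hx : 0 < x) : IntegrableOn (kg a b x) (Ioi 0) := by
  obtain ⟨m, hm⟩ := exists_nat_ge (b - a - 1)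
  have h0 : IntegrableOn (fun t : ℝ => t ^ (a - 1) * exp (-(x / 2) * t ^ (1 : ℝ))) (Ioi 0) :=
    integrableOn_rpow_mul_exp_neg_mul_rpow (by linarith) one_pos (by positivity)
  set K : ℝ := (m.factorial : ℝ) * (2 / x) ^ m * exp (x / 2)
  refine Integrable.mono' (h0.const_mul K) (kg_meas a b x) ?_
  refine (ae_restrict_iff' measurableSet_Ioi).2 (ae_of_all _ fun t ht => ?_)
  have ht : 0 < t := ht
  rw [Real.norm_of_nonneg (kg_pos a b x ht).le]
  have h1 : (1 + t) ^ (b - a - 1) ≤ (1 + t) ^ m := by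
    rw [← Real.rpow_natCast]
    exact Real.rpow_le_rpow_of_exponent_le (by linarith) hm
  have h2 : (1 + t) ^ m ≤ K * exp (x / 2 * t) := by
    have := Real.pow_div_factorial_le_exp (x / 2 * (1 + t)) (by positivity) m
    have h3 : (0 : ℝ) < m.factorial := by exact_mod_cast m.factorial_pos
    rw [div_le_iff₀ h3, mul_add, Real.exp_add, mul_one] at this
    calc (1 + t) ^ m = (2 / x) ^ m * (x / 2 + x / 2 * t) ^ m := by
          rw [← mul_pow]; congr 1; field_simp
      _ ≤ (2 / x) ^ m * (exp (x / 2) * exp (x / 2 * t) * m.factorial) := by gcongr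
      _ = _ := by simp only [K]; ring
  unfold kg
  calc exp (-x * t) * t ^ (a - 1) * (1 + t) ^ (b - a - 1)
      ≤ exp (-x * t) * t ^ (a - 1) * (K * exp (x / 2 * t)) := by
        gcongr; exact h1.trans h2
    _ = K * (t ^ (a - 1) * (exp (-x * t) * exp (x / 2 * t))) := by ring
    _ = _ := by
        rw [← Real.exp_add, Real.rpow_one]
        congr 3; ring

lemma kg_shift (a b x : ℝ) {t : ℝ} (ht : 0 < t) : kg (a + 1) (b + 1) x t = t * kg a b x t := by
  unfold kg
  rw [show a + 1 - 1 = (a - 1) + 1 by ring, Real.rpow_add_one ht.ne',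
    show b + 1 - (a + 1) - 1 = b - a - 1 by ring]
  ring

lemma kg_shift_b (a b x : ℝ) {t : ℝ} (ht : 0 < t) :
    kg a (b + 1) x t = (1 + t) * kg a b x t := by
  unfold kg
  rw [show b + 1 - a - 1 = (b - a - 1) + 1 by ring, Real.rpow_add_one (by positivity)]
  ring

lemma kI_hasDerivAt {a x : ℝ} (b : ℝ) (ha : 0 < a) (hx : 0 < x) :
    HasDerivAt (kI a b) (-kI (a + 1) (b + 1) x) x := by
  have key := hasDerivAt_integral_of_dominated_loc_of_deriv_le (μ := volume.restrict (Ioi (0 : ℝ)))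
    (F := fun y t => kg a b y t) (F' := fun y t => -kg (a + 1) (b + 1) y t) (x₀ := x)
    (s := Ioi (x / 2)) (bound := kg (a + 1) (b + 1) (x / 2)) (Ioi_mem_nhds (by linarith))
    (Eventually.of_forall fun y => kg_meas a b y) (kg_int b ha hx)
    (kg_meas _ _ _).neg
    ((ae_restrict_iff' measurableSet_Ioi).2 (ae_of_all _ fun t ht y hy => by
      have ht : 0 < t := ht
      have hy : x / 2 < y := hy
      rw [norm_neg, Real.norm_of_nonneg (kg_pos _ _ _ ht).le]
      unfold kg
      gcongr))
    (kg_int _ (by linarith) (by linarith))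
    ((ae_restrict_iff' measurableSet_Ioi).2 (ae_of_all _ fun t ht y hy => by
      have ht : 0 < t := ht
      rw [kg_shift _ _ _ ht]
      unfold kg
      have h : HasDerivAt (fun y : ℝ => exp (-y * t)) (exp (-y * t) * (-1 * t)) y :=
        (((hasDerivAt_id y).neg).mul_const t).exp
      convert! (h.mul_const (t ^ (a - 1))).mul_const ((1 + t) ^ (b - a - 1)) using 1
      ring))
  have := key.2
  rw [integral_neg] at this
  exact this

lemma kI_shift {a x : ℝ} (b : ℝ) (ha : 0 < a) (hx : 0 < x) :
    kI a b x + kI (a + 1) (b + 1) x = kI a (b + 1) x := by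
  unfold kI
  rw [← integral_add (kg_int b ha hx) (kg_int _ (by linarith) hx)]
  refine setIntegral_congr_fun measurableSet_Ioi fun t ht => ?_
  rw [kg_shift _ _ _ ht, kg_shift_b _ _ _ ht]; ring

lemma kI_ode {a x : ℝ} (b : ℝ) (ha : 0 < a) (hx : 0 < x) :
    x * kI (a + 1 + 1) (b + 1 + 1) x - (b - x) * kI (a + 1) (b + 1) x - a * kI a b x = 0 := by
  have i0 := kg_int b ha hx
  have i1 := kg_int (a := a + 1) (b + 1) (by linarith) hx
  have i2 := kg_int (a := a + 1 + 1) (b + 1 + 1) (by linarith) hx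
  have hint : IntegrableOn (fun t => x * kg (a + 1 + 1) (b + 1 + 1) x t -
      (b - x) * kg (a + 1) (b + 1) x t - a * kg a b x t) (Ioi 0) :=
    ((i2.const_mul x).sub (i1.const_mul (b - x))).sub (i0.const_mul a)
  have hder : ∀ t ∈ Ioi (0 : ℝ), HasDerivAt (fun t : ℝ => - kg (a + 1) (b + 1 + 1) x t)
      (x * kg (a + 1 + 1) (b + 1 + 1) x t -
      (b - x) * kg (a + 1) (b + 1) x t - a * kg a b x t) t := by
    intro t ht
    have ht : 0 < t := ht
    have h1 : HasDerivAt (fun t : ℝ => exp (-x * t)) (exp (-x * t) * (-x * 1)) t :=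
      ((hasDerivAt_id t).const_mul (-x)).exp
    have h2 : HasDerivAt (fun t : ℝ => t ^ (a + 1 - 1)) ((a + 1 - 1) * t ^ (a + 1 - 1 - 1)) t :=
      Real.hasDerivAt_rpow_const (Or.inl ht.ne')
    have h3 : HasDerivAt (fun t : ℝ => (1 + t) ^ (b + 1 + 1 - (a + 1) - 1))
        (1 * (b + 1 + 1 - (a + 1) - 1) * (1 + t) ^ (b + 1 + 1 - (a + 1) - 1 - 1)) t :=
      ((hasDerivAt_id t).const_add 1).rpow_const (Or.inl (by simp; positivity))
    have := ((h1.mul h2).mul h3).neg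
    convert! this using 1
    rw [kg_shift _ _ _ ht, kg_shift _ _ _ ht]
    unfold kg
    simp only [Pi.mul_apply]
    rw [show b + 1 + 1 - (a + 1) - 1 = (b - a - 1) + 1 by ring, Real.rpow_add_one (by positivity),
      show a + 1 - 1 = (a - 1) + 1 by ring, Real.rpow_add_one ht.ne',
      show b - a - 1 + 1 - 1 = b - a - 1 by ring, show a - 1 + 1 - 1 = a - 1 by ring]
    ring
  have hlim := tendsto_zero_of_hasDerivAt_of_integrableOn_Ioi hder hint
    (kg_int (a := a + 1) (b + 1 + 1) (by linarith) hx).neg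
  have hcont : ContinuousWithinAt (fun t : ℝ => - kg (a + 1) (b + 1 + 1) x t) (Ici 0) 0 := by
    apply ContinuousAt.continuousWithinAt
    unfold kg
    have h2 : ContinuousAt (fun t : ℝ => t ^ (a + 1 - 1)) 0 :=
      Real.continuousAt_rpow_const _ _ (Or.inr (by linarith))
    have h3 : ContinuousAt (fun t : ℝ => (1 + t) ^ (b + 1 + 1 - (a + 1) - 1)) 0 :=
      ContinuousAt.rpow_const (by fun_prop) (Or.inl (by simp))
    have h1 : ContinuousAt (fun t : ℝ => exp (-x * t)) 0 := by fun_prop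
    exact ((h1.mul h2).mul h3).neg
  have := integral_Ioi_of_hasDerivAt_of_tendsto hcont hder hint hlim
  have i21 : Integrable (fun t => x * kg (a + 1 + 1) (b + 1 + 1) x t -
      (b - x) * kg (a + 1) (b + 1) x t) (volume.restrict (Ioi 0)) :=
    (i2.const_mul x).sub (i1.const_mul (b - x))
  rw [integral_sub i21 (i0.const_mul a),
    integral_sub (i2.const_mul x) (i1.const_mul (b - x)), integral_const_mul, integral_const_mul,
    integral_const_mul] at this
  unfold kI
  rw [this]
  unfold kg
  rw [show a + 1 - 1 = a by ring, Real.zero_rpow ha.ne']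
  simp

lemma kbeta {a c : ℝ} (ha : 0 < a) (hc : 0 < c) :
    ∫ u in Ioo (0 : ℝ) 1, u ^ (a - 1) * (1 - u) ^ (c - 1) = Gamma a * Gamma c / Gamma (a + c) := by
  have h := Complex.betaIntegral_eq_Gamma_mul_div (a : ℂ) (c : ℂ) (by simpa) (by simpa)
  rw [Complex.betaIntegral, intervalIntegral.integral_of_le zero_le_one,
    integral_Ioc_eq_integral_Ioo, ← Complex.ofReal_add, Complex.Gamma_ofReal,
    Complex.Gamma_ofReal, Complex.Gamma_ofReal] at h
  apply Complex.ofReal_injective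
  push_cast
  rw [← h, ← integral_complex_ofReal]
  refine setIntegral_congr_fun measurableSet_Ioo fun u hu => ?_
  have h1 : 0 ≤ 1 - u := by linarith [hu.2]
  push_cast
  rw [Complex.ofReal_cpow hu.1.le, Complex.ofReal_cpow h1]
  push_cast
  rfl

lemma kg_zero_integral {a b : ℝ} (ha : 0 < a) (hb : b < 1) :
    ∫ t in Ioi (0 : ℝ), kg a b 0 t = Gamma a * Gamma (1 - b) / Gamma (a - b + 1) := by
  have himg : (fun u : ℝ => u / (1 - u)) '' Ioo 0 1 = Ioi 0 := by
    ext t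
    constructor
    · rintro ⟨u, ⟨h0, h1⟩, rfl⟩
      have : 0 < 1 - u := by linarith
      simp only [mem_Ioi]; positivity
    · intro ht
      have ht : 0 < t := ht
      refine ⟨t / (1 + t), ⟨by positivity, ?_⟩, ?_⟩
      · rw [div_lt_one (by positivity)]; linarith
      · field_simp; ring
  have hder : ∀ u ∈ Ioo (0 : ℝ) 1, HasDerivWithinAt (fun u : ℝ => u / (1 - u))
      (1 / (1 - u) ^ 2) (Ioo 0 1) u := by
    intro u hu
    have : 1 - u ≠ 0 := by linarith [hu.2]
    apply HasDerivAt.hasDerivWithinAt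
    convert! (hasDerivAt_id u).div ((hasDerivAt_id u).const_sub 1) this using 1
    simp only [id]
    ring
  have hinj : InjOn (fun u : ℝ => u / (1 - u)) (Ioo 0 1) := by
    intro u hu v hv huv
    have h1 : 1 - u ≠ 0 := by linarith [hu.2]
    have h2 : 1 - v ≠ 0 := by linarith [hv.2]
    rw [div_eq_div_iff h1 h2] at huv
    linarith
  rw [← himg, integral_image_eq_integral_abs_deriv_smul measurableSet_Ioo hder hinj,
    show a - b + 1 = a + (1 - b) by ring, ← kbeta ha (by linarith)]
  refine setIntegral_congr_fun measurableSet_Ioo fun u hu => ?_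
  have h1 : 0 < 1 - u := by linarith [hu.2]
  have h0 : 0 < u := hu.1
  simp only [smul_eq_mul]
  unfold kg
  rw [abs_of_pos (by positivity), show 1 + u / (1 - u) = (1 - u)⁻¹ by field_simp; ring,
    Real.div_rpow h0.le h1.le, Real.inv_rpow h1.le, ← Real.rpow_neg h1.le, div_eq_mul_inv,
    div_eq_mul_inv (u ^ (a - 1)), ← Real.rpow_neg h1.le, ← Real.rpow_natCast,
    ← Real.rpow_neg h1.le]
  rw [show 1 - b - 1 = -((2 : ℕ) : ℝ) + (-(a - 1) + -(b - a - 1)) by push_cast; ring,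
    Real.rpow_add h1, Real.rpow_add h1]
  simp only [neg_zero, zero_mul, Real.exp_zero]
  ring

lemma kI_lim0 {a b : ℝ} (ha : 0 < a) (hb : b < 1) :
    Tendsto (kI a b) (𝓝[>] 0) (𝓝 (Gamma a * Gamma (1 - b) / Gamma (a - b + 1))) := by
  rw [← kg_zero_integral ha hb]
  have hint : Integrable (kg a b 0) (volume.restrict (Ioi 0)) := by
    apply Integrable.of_integral_ne_zero
    rw [kg_zero_integral ha hb]
    have := Real.Gamma_pos_of_pos ha
    have := Real.Gamma_pos_of_pos (show 0 < 1 - b by linarith)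
    have := Real.Gamma_pos_of_pos (show 0 < a - b + 1 by linarith)
    positivity
  refine tendsto_integral_filter_of_dominated_convergence (kg a b 0)
    (Eventually.of_forall fun y => kg_meas a b y) ?_ hint ?_
  · filter_upwards [self_mem_nhdsWithin] with x hx
    have hx : 0 < x := hx
    refine (ae_restrict_iff' measurableSet_Ioi).2 (ae_of_all _ fun t ht => ?_)
    have ht : 0 < t := ht
    rw [Real.norm_of_nonneg (kg_pos _ _ _ ht).le]
    unfold kg
    gcongr
  · refine ae_of_all _ fun t => ?_
    have : Continuous fun x => kg a b x t := by unfold kg; fun_prop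
    exact (this.tendsto 0).mono_left nhdsWithin_le_nhds

lemma kI_scale (a b : ℝ) {x : ℝ} (hx : 0 < x) :
    x ^ b * kI (a + 1) (b + 1) x =
      ∫ s in Ioi (0 : ℝ), exp (-s) * s ^ a * (x + s) ^ (b - a - 1) := by
  have h := integral_comp_mul_left_Ioi
    (fun s : ℝ => exp (-s) * s ^ a * (x + s) ^ (b - a - 1)) 0 hx
  rw [mul_zero, smul_eq_mul, ← div_eq_inv_mul, eq_div_iff hx.ne'] at h
  rw [← h]
  unfold kI
  rw [← integral_const_mul, ← integral_mul_const]
  refine setIntegral_congr_fun measurableSet_Ioi fun t ht => ?_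
  have ht : 0 < t := ht
  unfold kg
  rw [show x + x * t = x * (1 + t) by ring, Real.mul_rpow hx.le ht.le,
    Real.mul_rpow hx.le (by positivity), show a + 1 - 1 = a by ring,
    show b + 1 - (a + 1) - 1 = b - a - 1 by ring, neg_mul]
  have : x ^ b = x ^ a * x ^ (b - a - 1) * x := by
    rw [← Real.rpow_add hx, ← Real.rpow_add_one hx.ne']; congr 1; ring
  rw [this]; ring

lemma kI_lim1 {a b : ℝ} (ha : 0 < a) (hb : 0 < b) (hb1 : b < 1) :
    Tendsto (fun x => x ^ b * kI (a + 1) (b + 1) x) (𝓝[>] 0) (𝓝 (Gamma b)) := by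
  have hG : Gamma b = ∫ s in Ioi (0 : ℝ), exp (-s) * s ^ (b - 1) := Real.Gamma_eq_integral hb
  rw [hG]
  have key : Tendsto (fun x : ℝ => ∫ s in Ioi (0 : ℝ), exp (-s) * s ^ a * (x + s) ^ (b - a - 1))
      (𝓝[>] 0) (𝓝 (∫ s in Ioi (0 : ℝ), exp (-s) * s ^ (b - 1))) := by
    have hsp : ∀ s : ℝ, 0 < s → s ^ (b - 1) = s ^ a * s ^ (b - a - 1) := by
      intro s hs; rw [← Real.rpow_add hs]; congr 1; ring
    refine tendsto_integral_filter_of_dominated_convergence (fun s => exp (-s) * s ^ (b - 1))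
      (Eventually.of_forall fun y => ?_) ?_ (Real.GammaIntegral_convergent hb) ?_
    · have : Measurable fun s : ℝ => exp (-s) * s ^ a * (y + s) ^ (b - a - 1) := by fun_prop
      exact this.aestronglyMeasurable
    · filter_upwards [self_mem_nhdsWithin] with x hx
      have hx : 0 < x := hx
      refine (ae_restrict_iff' measurableSet_Ioi).2 (ae_of_all _ fun s hs => ?_)
      have hs : 0 < s := hs
      rw [Real.norm_of_nonneg (by positivity), hsp s hs, mul_assoc]
      have := Real.rpow_le_rpow_of_nonpos hs (show s ≤ x + s by linarith)
        (show b - a - 1 ≤ 0 by linarith)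
      gcongr
    · refine (ae_restrict_iff' measurableSet_Ioi).2 (ae_of_all _ fun s hs => ?_)
      have hs : 0 < s := hs
      have : ContinuousAt (fun x : ℝ => exp (-s) * s ^ a * (x + s) ^ (b - a - 1)) 0 := by
        apply ContinuousAt.mul continuousAt_const
        exact ContinuousAt.rpow_const (by fun_prop) (Or.inl (by simpa using hs.ne'))
      have h := this.tendsto
      simp only [zero_add] at h
      rw [hsp s hs, ← mul_assoc]
      exact h.mono_left nhdsWithin_le_nhds
  refine key.congr' ?_
  filter_upwards [self_mem_nhdsWithin] with x hx
  exact (kI_scale a b hx).symm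

/-- The connection-formula right-hand side. -/
noncomputable def kR (a b x : ℝ) : ℝ :=
  Gamma (1 - b) / Gamma (a - b + 1) * kM a b x +
    Gamma (b - 1) / Gamma a * (x ^ (1 - b) * kM (a - b + 1) (1 - b + 1) x)

lemma const_of_lim {f : ℝ → ℝ} {l : ℝ} (hd : ∀ x, 0 < x → HasDerivAt f 0 x)
    (hl : Tendsto f (𝓝[>] 0) (𝓝 l)) {x : ℝ} (hx : 0 < x) : f x = l := by
  obtain ⟨c, hc⟩ := isOpen_Ioi.exists_is_const_of_deriv_eq_zero (isPreconnected_Ioi (a := (0 : ℝ)))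
    (fun y hy => (hd y hy).differentiableAt.differentiableWithinAt)
    (fun y hy => (hd y hy).deriv)
  rw [hc x hx]
  refine tendsto_nhds_unique (Tendsto.congr' ?_ tendsto_const_nhds) hl
  filter_upwards [self_mem_nhdsWithin] with y hy
  exact (hc y hy).symm

lemma wronskian_unique {a b : ℝ} {D D' D'' M M' M'' : ℝ → ℝ} (hb : 0 < b)
    (hD : ∀ x, 0 < x → HasDerivAt D (D' x) x) (hD' : ∀ x, 0 < x → HasDerivAt D' (D'' x) x)
    (hM : ∀ x, 0 < x → HasDerivAt M (M' x) x) (hM' : ∀ x, 0 < x → HasDerivAt M' (M'' x) x)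
    (oD : ∀ x, 0 < x → x * D'' x + (b - x) * D' x - a * D x = 0)
    (oM : ∀ x, 0 < x → x * M'' x + (b - x) * M' x - a * M x = 0)
    (hpos : ∀ x, 0 < x → 0 < M x)
    (lM : Tendsto M (𝓝[>] 0) (𝓝 1)) {m : ℝ} (lM' : Tendsto M' (𝓝[>] 0) (𝓝 m))
    (lD : Tendsto D (𝓝[>] 0) (𝓝 0)) (lD' : Tendsto (fun x => x ^ b * D' x) (𝓝[>] 0) (𝓝 0))
    {x : ℝ} (hx : 0 < x) : D x = 0 := by
  have hW : ∀ x, 0 < x → exp (-x) * (x ^ b * D x * M' x - x ^ b * D' x * M x) = 0 := by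
    intro x hx
    refine const_of_lim (f := fun x => exp (-x) * (x ^ b * D x * M' x - x ^ b * D' x * M x))
      ?_ ?_ hx
    · intro x hx
      have h1 : HasDerivAt (fun x : ℝ => exp (-x)) (exp (-x) * (-1)) x := (hasDerivAt_neg x).exp
      have h2 : HasDerivAt (fun x : ℝ => x ^ b) (b * x ^ (b - 1)) x :=
        Real.hasDerivAt_rpow_const (Or.inl hx.ne')
      have h3 := h1.mul (((h2.mul (hD x hx)).mul (hM' x hx)).sub
        ((h2.mul (hD' x hx)).mul (hM x hx)))
      convert! h3 using 1
      simp only [Pi.mul_apply, Pi.sub_apply]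
      have e : x ^ b = x ^ (b - 1) * x := by
        rw [← Real.rpow_add_one hx.ne']; congr 1; ring
      rw [e]
      linear_combination exp (-x) * x ^ (b - 1) * (M x * oD x hx - D x * oM x hx)
    · have l1 : Tendsto (fun x : ℝ => exp (-x)) (𝓝[>] 0) (𝓝 1) := by
        have : Continuous fun x : ℝ => exp (-x) := by fun_prop
        simpa using (this.tendsto 0).mono_left nhdsWithin_le_nhds
      have l2 : Tendsto (fun x : ℝ => x ^ b) (𝓝[>] 0) (𝓝 0) := by
        have := (Real.continuousAt_rpow_const (0 : ℝ) b (Or.inr hb.le)).tendsto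
        rw [Real.zero_rpow hb.ne'] at this
        exact this.mono_left nhdsWithin_le_nhds
      simpa using l1.mul (((l2.mul lD).mul lM').sub (lD'.mul lM))
  have hq : D x / M x = 0 := by
    refine const_of_lim (f := fun x => D x / M x) ?_ (by
      have h := lD.div lM one_ne_zero
      rw [zero_div] at h
      exact h) hx
    intro x hx
    have h := (hD x hx).div (hM x hx) (hpos x hx).ne'
    convert! h using 1
    have hw := hW x hx
    have hxb : 0 < x ^ b := by positivity
    have : x ^ b * (D x * M' x - D' x * M x) = 0 := by
      rcases mul_eq_zero.1 hw with h | h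
      · exact absurd h (Real.exp_pos _).ne'
      · linarith
    rcases mul_eq_zero.1 this with h | h
    · exact absurd h hxb.ne'
    · rw [show D' x * M x - D x * M' x = 0 by linarith]; simp
  rcases div_eq_zero_iff.1 hq with h | h
  · exact h
  · exact absurd h (hpos x hx).ne'

lemma kM_cont0 {a b : ℝ} (hb : ∀ n : ℕ, b + n ≠ 0) : Tendsto (kM a b) (𝓝[>] 0) (𝓝 1) := by
  have := (kM_hasDerivAt (a := a) hb 0).continuousAt.tendsto
  rw [kM_zero hb] at this
  exact this.mono_left nhdsWithin_le_nhds

lemma kM2_hasDerivAt {a c : ℝ} (hc : ∀ n : ℕ, c + n ≠ 0) {x : ℝ} (e : ℝ) (hx : 0 < x) :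
    HasDerivAt (fun x : ℝ => x ^ e * kM a c x)
      (e * x ^ (e - 1) * kM a c x + x ^ e * (a / c * kM (a + 1) (c + 1) x)) x := by
  have h2 : HasDerivAt (fun x : ℝ => x ^ e) (e * x ^ (e - 1)) x :=
    Real.hasDerivAt_rpow_const (Or.inl hx.ne')
  exact h2.mul (kM_hasDerivAt hc x)

lemma kconn_base {a b : ℝ} (ha : 0 < a) (hb : 0 < b) (hb1 : b < 1) {x : ℝ} (hx : 0 < x) :
    kI a b x = Gamma a * kR a b x := by
  have hbn : ∀ n : ℕ, b + n ≠ 0 := fun n => by positivity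
  have hbc : ∀ n : ℕ, 1 - b + n ≠ 0 := fun n => by
    have : 0 < 1 - b := by linarith
    positivity
  set c1 := Gamma a * Gamma (1 - b) / Gamma (a - b + 1) with hc1
  set c2 := Gamma (b - 1) with hc2
  set α := a - b + 1 with hα
  set γ := 1 - b + 1 with hγ
  have hγn : ∀ n : ℕ, γ + n ≠ 0 := hb_succ hbc
  have hga := (Real.Gamma_pos_of_pos ha).ne'
  suffices h : kI a b x - c1 * kM a b x - c2 * (x ^ (1 - b) * kM α γ x) = 0 by
    unfold kR
    rw [← hα, ← hγ, ← hc2]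
    have e : Gamma a * (Gamma (1 - b) / Gamma α * kM a b x + c2 / Gamma a *
      (x ^ (1 - b) * kM α γ x)) = c1 * kM a b x + c2 * (x ^ (1 - b) * kM α γ x) := by
      rw [hc1]; field_simp
    rw [e]; linarith
  refine wronskian_unique (a := a) (b := b)
    (D := fun x => kI a b x - c1 * kM a b x - c2 * (x ^ (1 - b) * kM α γ x))
    (D' := fun x => -kI (a + 1) (b + 1) x - c1 * (a / b * kM (a + 1) (b + 1) x) -
      c2 * ((1 - b) * (x ^ (1 - b - 1) * kM α γ x) +
        α / γ * (x ^ (1 - b) * kM (α + 1) (γ + 1) x)))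
    (D'' := fun x => -(-kI (a + 1 + 1) (b + 1 + 1) x) -
      c1 * (a / b * ((a + 1) / (b + 1) * kM (a + 1 + 1) (b + 1 + 1) x)) -
      c2 * ((1 - b) * ((1 - b - 1) * x ^ (1 - b - 1 - 1) * kM α γ x +
          x ^ (1 - b - 1) * (α / γ * kM (α + 1) (γ + 1) x)) +
        α / γ * ((1 - b) * x ^ (1 - b - 1) * kM (α + 1) (γ + 1) x +
          x ^ (1 - b) * ((α + 1) / (γ + 1) * kM (α + 1 + 1) (γ + 1 + 1) x))))
    (M := kM a b) (M' := fun x => a / b * kM (a + 1) (b + 1) x)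
    (M'' := fun x => a / b * ((a + 1) / (b + 1) * kM (a + 1 + 1) (b + 1 + 1) x))
    (m := a / b * 1) hb ?_ ?_ ?_ ?_ ?_ ?_ ?_ ?_ ?_ ?_ ?_ hx
  · intro x hx
    have := ((kI_hasDerivAt b ha hx).sub ((kM_hasDerivAt (a := a) hbn x).const_mul c1)).sub
      ((kM2_hasDerivAt (a := α) hγn (1 - b) hx).const_mul c2)
    convert! this using 1
    ring
  · intro x hx
    have := ((kI_hasDerivAt (a := a + 1) (b + 1) (by linarith) hx).neg.sub
      (((kM_hasDerivAt (a := a + 1) (hb_succ hbn) x).const_mul (a / b)).const_mul c1)).sub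
      ((((kM2_hasDerivAt (a := α) hγn (1 - b - 1) hx).const_mul (1 - b)).add
        ((kM2_hasDerivAt (a := α + 1) (hb_succ hγn) (1 - b) hx).const_mul (α / γ))).const_mul c2)
    convert! this using 1
  · intro x hx
    exact kM_hasDerivAt hbn x
  · intro x hx
    exact (kM_hasDerivAt (hb_succ hbn) x).const_mul _
  · intro x hx
    have o1 := kI_ode b ha hx
    have o2 := kM_C (a := a) hbn x
    have o3 := kM_C (a := α) hγn x
    have hb0 := hb.ne'
    have hγ0 := hb_zero hγn
    have e1 : x ^ (1 - b - 1) = x ^ (1 - b - 1 - 1) * x := by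
      rw [← Real.rpow_add_one hx.ne']; congr 1; ring
    have e2 : x ^ (1 - b) = x ^ (1 - b - 1 - 1) * x * x := by
      rw [← Real.rpow_add_one hx.ne', ← Real.rpow_add_one hx.ne']; congr 1; ring
    rw [e2, e1]
    generalize x ^ (1 - b - 1 - 1) = q
    generalize (a + 1) / (b + 1) * kM (a + 1 + 1) (b + 1 + 1) x = M2 at *
    generalize (α + 1) / (γ + 1) * kM (α + 1 + 1) (γ + 1 + 1) x = N2 at *
    generalize kM (α + 1) (γ + 1) x = N1 at *
    generalize kM (a + 1) (b + 1) x = M1 at *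
    generalize kM a b x = M0 at *
    generalize kM α γ x = N0 at *
    have o2' : x * (a / b * M2) + (b - x) * (a / b * M1) - a * M0 = 0 := by
      have : a * M0 = a / b * (b * M0) := by field_simp
      rw [this, ← o2]; ring
    have o3' : x * (α / γ * N2) + (γ - x) * (α / γ * N1) - α * N0 = 0 := by
      have : α * N0 = α / γ * (γ * N0) := by field_simp
      rw [this, ← o3]; ring
    generalize α / γ = r at *
    generalize a / b = r' at *
    rw [hα, hγ] at o3'
    linear_combination o1 - c1 * o2' - c2 * q * x ^ 2 * o3'
  · intro x hx
    have o2 := kM_C (a := a) hbn x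
    have hb0 := hb.ne'
    have : a * kM a b x = a / b * (b * kM a b x) := by field_simp
    rw [this, ← o2]; ring
  · intro x hx
    exact kM_pos ha hb hx.le
  · exact kM_cont0 hbn
  · exact (kM_cont0 (hb_succ hbn)).const_mul _
  · have l2 : Tendsto (fun x : ℝ => x ^ (1 - b)) (𝓝[>] 0) (𝓝 0) := by
      have h1 : 0 < 1 - b := by linarith
      have := (Real.continuousAt_rpow_const (0 : ℝ) (1 - b) (Or.inr h1.le)).tendsto
      rw [Real.zero_rpow h1.ne'] at this
      exact this.mono_left nhdsWithin_le_nhds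
    have := ((kI_lim0 ha hb1).sub ((kM_cont0 (a := a) hbn).const_mul c1)).sub
      ((l2.mul (kM_cont0 (a := α) hγn)).const_mul c2)
    have e : Gamma a * Gamma (1 - b) / Gamma (a - b + 1) - c1 * 1 - c2 * (0 * 1) = 0 := by
      rw [hc1]; ring
    rw [e] at this
    exact this
  · have l2 : Tendsto (fun x : ℝ => x ^ b) (𝓝[>] 0) (𝓝 0) := by
      have := (Real.continuousAt_rpow_const (0 : ℝ) b (Or.inr hb.le)).tendsto
      rw [Real.zero_rpow hb.ne'] at this
      exact this.mono_left nhdsWithin_le_nhds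
    have l0 : Tendsto (fun x : ℝ => x) (𝓝[>] 0) (𝓝 0) := tendsto_id.mono_left nhdsWithin_le_nhds
    have key := ((kI_lim1 ha hb hb1).neg.sub ((l2.mul
      ((kM_cont0 (a := a + 1) (hb_succ hbn)).const_mul (a / b))).const_mul c1)).sub
      ((((kM_cont0 (a := α) hγn).const_mul (1 - b)).add ((l0.mul
        (kM_cont0 (a := α + 1) (hb_succ hγn))).const_mul (α / γ))).const_mul c2)
    have hG : Gamma b = (b - 1) * c2 := by
      rw [hc2, ← Real.Gamma_add_one (by linarith)]; congr 1; ring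
    have e : -Gamma b - c1 * (0 * (a / b * 1)) - c2 * ((1 - b) * 1 + α / γ * (0 * 1)) = 0 := by
      rw [hG]; ring
    rw [e] at key
    refine key.congr' ?_
    filter_upwards [self_mem_nhdsWithin] with x hx
    have hx : 0 < x := hx
    have e1 : x ^ b * x ^ (1 - b - 1) = 1 := by
      rw [← Real.rpow_add hx, show b + (1 - b - 1) = 0 by ring, Real.rpow_zero]
    have e2 : x ^ b * x ^ (1 - b) = x := by
      rw [← Real.rpow_add hx, show b + (1 - b) = 1 by ring, Real.rpow_one]
    linear_combination (c2 * (1 - b) * kM α γ x) * e1 +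
      (c2 * (α / γ * kM (α + 1) (γ + 1) x)) * e2

lemma kR_step {a b x : ℝ} (hb : 0 < b) (hn : ∀ n : ℤ, b ≠ n) (hx : 0 < x) :
    ∃ d, HasDerivAt (kR a b) d x ∧ kR a b x - d = kR a (b + 1) x := by
  have hbn : ∀ n : ℕ, b + n ≠ 0 := fun n => by positivity
  have hbc : ∀ n : ℕ, 1 - b + n ≠ 0 := fun n h => by
    apply hn (n + 1); push_cast; linarith
  have hγn := hb_succ hbc
  have hd := ((kM_hasDerivAt (a := a) hbn x).const_mul (Gamma (1 - b) / Gamma (a - b + 1))).add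
    ((kM2_hasDerivAt (a := a - b + 1) hγn (1 - b) hx).const_mul (Gamma (b - 1) / Gamma a))
  refine ⟨_, hd, ?_⟩
  have g1 : Gamma (1 - b) / Gamma (a - b + 1) * ((b - a) / b) = Gamma (-b) / Gamma (a - b) := by
    rw [show 1 - b = -b + 1 by ring, Real.Gamma_add_one (by linarith)]
    by_cases hab : a - b = 0
    · rw [hab, show b - a = 0 by linarith]; simp
    · rw [Real.Gamma_add_one hab]
      by_cases hg : Gamma (a - b) = 0
      · rw [hg]; simp
      · field_simp; ring
  have g2 : Gamma b = (b - 1) * Gamma (b - 1) := by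
    have : b - 1 ≠ 0 := by intro h; apply hn 1; push_cast; linarith
    rw [← Real.Gamma_add_one this]; congr 1; ring
  have hB := kM_B (a := a) hbn x
  have hC := kM_C (a := a - b) hbc x
  unfold kR
  rw [show 1 - (b + 1) = -b by ring, show a - (b + 1) + 1 = a - b by ring,
    show b + 1 - 1 = b by ring, show -b + 1 = 1 - b by ring, show 1 - b - 1 = -b by ring]
  rw [← g1, g2]
  have e2 : x ^ (1 - b) = x ^ (-b) * x := by
    rw [← Real.rpow_add_one hx.ne']; congr 1; ring
  rw [e2]
  linear_combination (Gamma (1 - b) / Gamma (a - b + 1)) * hB -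
    (Gamma (b - 1) / Gamma a * x ^ (-b)) * hC

lemma kconn_nat {a b : ℝ} (ha : 0 < a) (hb : 0 < b) (hb1 : b < 1) (n : ℕ) :
    ∀ x : ℝ, 0 < x → kI a (b + n) x = Gamma a * kR a (b + n) x := by
  induction n with
  | zero => intro x hx; simpa using kconn_base ha hb hb1 hx
  | succ n ih =>
    intro x hx
    have hni : ∀ m : ℤ, b + n ≠ m := by
      intro m h
      have h1 : ((n : ℤ) : ℝ) < (m : ℝ) := by push_cast; linarith
      have h2 : (m : ℝ) < ((n + 1 : ℤ) : ℝ) := by push_cast; linarith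
      have h1 : (n : ℤ) < m := by exact_mod_cast h1
      have h2 : m < (n + 1 : ℤ) := by exact_mod_cast h2
      omega
    obtain ⟨d, hd, he⟩ := kR_step (a := a) (b := b + n) (by positivity) hni hx
    have h1 := kI_hasDerivAt (b + n) ha hx
    have h2 : HasDerivAt (kI a (b + n)) (Gamma a * d) x := by
      refine (hd.const_mul (Gamma a)).congr_of_eventuallyEq ?_
      filter_upwards [Ioi_mem_nhds hx] with y hy
      exact ih y hy
    have h3 := h1.unique h2
    push_cast
    rw [← add_assoc, ← he, mul_sub, ← h3, ← ih x hx, ← kI_shift _ ha hx]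
    ring

lemma kconn {a b x : ℝ} (ha : 0 < a) (hb : 0 < b) (hn : ∀ n : ℤ, b ≠ n) (hx : 0 < x) :
    kI a b x = Gamma a * kR a b x := by
  have h0 : Int.fract b ≠ 0 := by
    intro h
    obtain ⟨z, hz⟩ := Int.fract_eq_zero_iff.1 h
    exact hn z hz.symm
  have h1 : 0 < Int.fract b := lt_of_le_of_ne (Int.fract_nonneg b) (Ne.symm h0)
  have h2 : Int.fract b + (⌊b⌋.toNat : ℝ) = b := by
    have h3 : ((⌊b⌋.toNat : ℤ)) = ⌊b⌋ := Int.toNat_of_nonneg (Int.floor_nonneg.2 hb.le)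
    have h4 : ((⌊b⌋.toNat : ℝ)) = ((⌊b⌋ : ℤ) : ℝ) := by exact_mod_cast congrArg (Int.cast (R := ℝ)) h3
    rw [h4]; exact Int.fract_add_floor b
  have := kconn_nat ha h1 (Int.fract_lt_one b) ⌊b⌋.toNat x hx
  rwa [h2] at this

lemma poch_cast (a : ℝ) (n : ℕ) :
    (ascPochhammer ℂ n).eval (a : ℂ) = (((ascPochhammer ℝ n).eval a : ℝ) : ℂ) := by
  induction n with
  | zero => simp
  | succ n ih => rw [ascPochhammer_succ_eval, ascPochhammer_succ_eval, ih]; push_cast; rfl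

lemma whittakerM_real (κ ν : ℝ) {x : ℝ} (hx : 0 < x) :
    whittakerM (κ : ℂ) (ν : ℂ) x =
      ((exp (-x / 2) * x ^ (1 / 2 + ν) * kM (1 / 2 - κ + ν) (2 * ν + 1) x : ℝ) : ℂ) := by
  unfold whittakerM kM
  rw [Complex.ofReal_mul, Complex.ofReal_mul, Complex.ofReal_tsum, Real.rpow_def_of_pos hx]
  congr 1
  · push_cast
    rw [mul_comm (1 / 2 + (ν : ℂ))]
  · apply tsum_congr; intro n
    unfold kcf
    have e1 : (1 / 2 - (κ : ℂ) + (ν : ℂ)) = ((1 / 2 - κ + ν : ℝ) : ℂ) := by push_cast; rfl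
    have e2 : (2 * (ν : ℂ) + 1) = ((2 * ν + 1 : ℝ) : ℂ) := by push_cast; rfl
    rw [e1, e2, poch_cast, poch_cast]
    push_cast
    rfl

lemma whittakerW_real {κ ν x : ℝ} (hx : 0 < x) (hν : 0 ≤ ν) (hκ : κ ≤ ν)
    (hn : ∀ n : ℤ, 2 * ν ≠ n) :
    whittakerW (κ : ℂ) (ν : ℂ) x =
      ((exp (-x / 2) * x ^ (1 / 2 + ν) / Gamma (1 / 2 - κ + ν) *
        kI (1 / 2 - κ + ν) (2 * ν + 1) x : ℝ) : ℂ) := by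
  have ha : 0 < 1 / 2 - κ + ν := by linarith
  have hga := (Real.Gamma_pos_of_pos ha).ne'
  rw [kconn ha (by linarith) (fun n h => hn (n - 1) (by push_cast; linarith)) hx]
  unfold whittakerW kR
  have hm : -(ν : ℂ) = ((-ν : ℝ) : ℂ) := by push_cast; rfl
  have e0 : -(2 * (ν : ℂ)) = ((1 - (2 * ν + 1) : ℝ) : ℂ) := by push_cast; ring
  have e1 : (1 / 2 - (κ : ℂ) - (ν : ℂ)) = ((1 / 2 - κ + ν - (2 * ν + 1) + 1 : ℝ) : ℂ) := by
    push_cast; ring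
  have e2 : (2 * (ν : ℂ)) = ((2 * ν + 1 - 1 : ℝ) : ℂ) := by push_cast; ring
  have e3 : (1 / 2 - (κ : ℂ) + (ν : ℂ)) = ((1 / 2 - κ + ν : ℝ) : ℂ) := by push_cast; rfl
  rw [e0, e1, e2, e3, hm, whittakerM_real κ ν hx, whittakerM_real κ (-ν) hx,
    Complex.Gamma_ofReal, Complex.Gamma_ofReal, Complex.Gamma_ofReal, Complex.Gamma_ofReal]
  rw [← Complex.ofReal_div, ← Complex.ofReal_div, ← Complex.ofReal_mul, ← Complex.ofReal_mul,
    ← Complex.ofReal_add]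
  congr 1
  rw [show 1 / 2 - κ + -ν = 1 / 2 - κ + ν - (2 * ν + 1) + 1 by ring,
    show 2 * -ν + 1 = 1 - (2 * ν + 1) + 1 by ring,
    show 1 / 2 + -ν = (1 / 2 + ν) + (1 - (2 * ν + 1)) by ring,
    Real.rpow_add hx (1 / 2 + ν) (1 - (2 * ν + 1))]
  generalize Gamma (1 / 2 - κ + ν) = G at *
  generalize Gamma (1 / 2 - κ + ν - (2 * ν + 1) + 1) = G1
  generalize x ^ (1 / 2 + ν) = X
  generalize x ^ (1 - (2 * ν + 1)) = Y
  generalize kM (1 / 2 - κ + ν) (2 * ν + 1) x = A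
  generalize kM (1 / 2 - κ + ν - (2 * ν + 1) + 1) (1 - (2 * ν + 1) + 1) x = B
  field_simp

lemma F_ne_zero {κ x₀ : ℝ} (hx : 0 < x₀) {F : ℂ → ℂ} (hF : Differentiable ℂ F)
    (hFW : ∀ μ : ℂ, (∀ n : ℤ, 2*μ ≠ (n:ℂ)) → F μ = whittakerW (κ:ℂ) μ x₀)
    {μ : ℝ} (hμ : 0 ≤ μ) (hκ : κ ≤ μ) : F (μ : ℂ) ≠ 0 := by
  set h : ℝ → ℝ := fun ν => exp (-x₀ / 2) * x₀ ^ (1 / 2 + ν) / Gamma (1 / 2 - κ + ν) with hh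
  set J : ℝ := ∫ t in Ioo (1 : ℝ) 2, kg (1 / 2 - κ + μ) (2 * μ + 1) x₀ t with hJ
  have ha : 0 < 1 / 2 - κ + μ := by linarith
  have hsub : Ioo (1 : ℝ) 2 ⊆ Ioi 0 := fun t ht => lt_trans one_pos ht.1
  have hJint : IntegrableOn (kg (1 / 2 - κ + μ) (2 * μ + 1) x₀) (Ioo 1 2) :=
    (kg_int _ ha hx).mono_set hsub
  have hJpos : 0 < J := by
    rw [hJ, setIntegral_pos_iff_support_of_nonneg_ae _ hJint]
    · have : Ioo (1 : ℝ) 2 ⊆ Function.support (kg (1 / 2 - κ + μ) (2 * μ + 1) x₀) ∩ Ioo 1 2 :=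
        fun t ht => ⟨(kg_pos _ _ _ (hsub ht)).ne', ht⟩
      refine lt_of_lt_of_le ?_ (measure_mono this)
      simp
    · refine (ae_restrict_iff' measurableSet_Ioo).2 (ae_of_all _ fun t ht => ?_)
      exact (kg_pos _ _ _ (hsub ht)).le
  have hev : ∀ᶠ ν in 𝓝[>] μ, h ν * J ≤ (F (ν : ℂ)).re := by
    have hlt : μ < (⌊2 * μ⌋ + 1) / 2 := by
      have := Int.lt_floor_add_one (2 * μ); linarith
    filter_upwards [Ioo_mem_nhdsGT hlt] with ν hν
    obtain ⟨h1, h2⟩ := hν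
    have hn : ∀ n : ℤ, 2 * ν ≠ n := by
      intro n hn
      have h3 := Int.floor_le (2 * μ)
      have h4 : ((⌊2 * μ⌋ : ℤ) : ℝ) < (n : ℝ) := by linarith
      have h5 : (n : ℝ) < ((⌊2 * μ⌋ + 1 : ℤ) : ℝ) := by push_cast; linarith
      have h4 : ⌊2 * μ⌋ < n := by exact_mod_cast h4
      have h5 : n < ⌊2 * μ⌋ + 1 := by exact_mod_cast h5
      omega
    rw [hFW (ν : ℂ) (fun n h => hn n (by exact_mod_cast h)),
      whittakerW_real hx (by linarith) (by linarith) hn, Complex.ofReal_re]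
    have hgp := Real.Gamma_pos_of_pos (show 0 < 1 / 2 - κ + ν by linarith)
    have hIJ : J ≤ kI (1 / 2 - κ + ν) (2 * ν + 1) x₀ := by
      have hi := kg_int (a := 1 / 2 - κ + ν) (2 * ν + 1) (by linarith) hx
      calc J ≤ ∫ t in Ioo (1 : ℝ) 2, kg (1 / 2 - κ + ν) (2 * ν + 1) x₀ t := by
            refine setIntegral_mono_on hJint (hi.mono_set hsub) measurableSet_Ioo fun t ht => ?_
            have ht1 : 1 ≤ t := ht.1.le
            unfold kg
            have : 0 < t := by linarith
            have u1 : t ^ (1 / 2 - κ + μ - 1) ≤ t ^ (1 / 2 - κ + ν - 1) :=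
              Real.rpow_le_rpow_of_exponent_le ht1 (by linarith)
            have u2 : (1 + t) ^ (2 * μ + 1 - (1 / 2 - κ + μ) - 1) ≤
                (1 + t) ^ (2 * ν + 1 - (1 / 2 - κ + ν) - 1) :=
              Real.rpow_le_rpow_of_exponent_le (by linarith) (by linarith)
            gcongr
        _ ≤ _ := by
            refine setIntegral_mono_set hi ?_ hsub.eventuallyLE
            refine (ae_restrict_iff' measurableSet_Ioi).2 (ae_of_all _ fun t ht => ?_)
            exact (kg_pos _ _ _ ht).le
    have : 0 ≤ h ν := by simp only [hh]; positivity
    exact mul_le_mul_of_nonneg_left hIJ this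
  have hcF : Tendsto (fun ν : ℝ => (F (ν : ℂ)).re) (𝓝[>] μ) (𝓝 (F (μ : ℂ)).re) := by
    have : Continuous fun ν : ℝ => (F (ν : ℂ)).re :=
      Complex.continuous_re.comp (hF.continuous.comp Complex.continuous_ofReal)
    exact (this.tendsto μ).mono_left nhdsWithin_le_nhds
  have hch : Tendsto (fun ν : ℝ => h ν * J) (𝓝[>] μ) (𝓝 (h μ * J)) := by
    have hg : ContinuousAt Gamma (1 / 2 - κ + μ) :=
      (Real.differentiableAt_Gamma fun m => by
        have : (0 : ℝ) ≤ m := by positivity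
        linarith).continuousAt
    have hg' : ContinuousAt (fun ν : ℝ => Gamma (1 / 2 - κ + ν)) μ :=
      ContinuousAt.comp (f := fun ν : ℝ => 1 / 2 - κ + ν) hg (by fun_prop)
    have hr : ContinuousAt (fun ν : ℝ => x₀ ^ (1 / 2 + ν)) μ :=
      ContinuousAt.rpow continuousAt_const (by fun_prop) (Or.inl hx.ne')
    have : ContinuousAt (fun ν => h ν * J) μ :=
      ((continuousAt_const.mul hr).div hg' (Real.Gamma_pos_of_pos ha).ne').mul continuousAt_const
    exact this.tendsto.mono_left nhdsWithin_le_nhds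
  have hle : h μ * J ≤ (F (μ : ℂ)).re := le_of_tendsto_of_tendsto hch hcF hev
  have hpos : 0 < h μ := by
    have := Real.Gamma_pos_of_pos ha
    simp only [hh]; positivity
  intro h0
  rw [h0, Complex.zero_re] at hle
  exact absurd (mul_pos hpos hJpos) (not_lt.2 hle)

lemma F_ne_zero_abs {κ x₀ : ℝ} (hx : 0 < x₀) {F : ℂ → ℂ} (hF : Differentiable ℂ F)
    (hFW : ∀ μ : ℂ, (∀ n : ℤ, 2*μ ≠ (n:ℂ)) → F μ = whittakerW (κ:ℂ) μ x₀)
    {μ : ℝ} (hκ : κ ≤ |μ|) : F (μ : ℂ) ≠ 0 := by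
  rcases le_total 0 μ with h | h
  · exact F_ne_zero hx hF hFW h (by rwa [abs_of_nonneg h] at hκ)
  · have := F_ne_zero (κ := κ) hx (F := fun z => F (-z)) (hF.comp differentiable_neg)
      (fun z hz => by
        rw [hFW (-z) (fun n hn => hz (-n) (by push_cast; rw [← hn]; ring))]
        unfold whittakerW
        rw [neg_neg, show -(2 * -z) = 2 * z by ring, show 2 * -z = -(2 * z) by ring,
          show 1 / 2 - (κ : ℂ) - -z = 1 / 2 - κ + z by ring,
          show 1 / 2 - (κ : ℂ) + -z = 1 / 2 - κ - z by ring]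
        ring) (μ := -μ) (by linarith) (by rwa [abs_of_nonpos h] at hκ)
    simpa using this

/-- The entire function `μ ↦ W_{κ,μ}(x₀)` has finitely many real zeros; there are
none when `κ ≤ 0`, and for `κ > 0` they all lie in `(-κ, κ)`. -/
theorem stmt_16 (κ x₀ : ℝ) (hx : 0 < x₀) (F : ℂ → ℂ) (hF : Differentiable ℂ F)
    (hFW : ∀ μ : ℂ, (∀ n : ℤ, 2*μ ≠ (n:ℂ)) → F μ = whittakerW (κ:ℂ) μ x₀) :
    {μ : ℝ | F (μ:ℂ) = 0}.Finite ∧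
    (κ ≤ 0 → {μ : ℝ | F (μ:ℂ) = 0} = ∅) ∧
    (0 < κ → {μ : ℝ | F (μ:ℂ) = 0} ⊆ Set.Ioo (-κ) κ) := by
  have hmem : ∀ μ : ℝ, F (μ : ℂ) = 0 → |μ| < κ := by
    intro μ h
    by_contra hc
    exact F_ne_zero_abs hx hF hFW (not_lt.1 hc) h
  refine ⟨?_, ?_, ?_⟩
  · by_contra hinf
    have hinf : {μ : ℝ | F (μ:ℂ) = 0}.Infinite := hinf
    have hinf' : ((fun μ : ℝ => (μ : ℂ)) '' {μ : ℝ | F (μ:ℂ) = 0}).Infinite :=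
      hinf.image Complex.ofReal_injective.injOn
    obtain ⟨z, -, hz⟩ := hinf'.exists_accPt_of_subset_isCompact
      (isCompact_closedBall (0 : ℂ) κ) (by
        rintro _ ⟨μ, hμ, rfl⟩
        have := hmem μ hμ
        simpa using this.le)
    have hfreq : ∃ᶠ w in 𝓝[≠] z, F w = 0 := by
      rw [accPt_iff_frequently_nhdsNE] at hz
      refine hz.mono ?_
      rintro _ ⟨μ, hμ, rfl⟩
      exact hμ
    have han : AnalyticOnNhd ℂ F univ := fun w _ => hF.analyticAt w
    have h0 := han.eqOn_zero_of_preconnected_of_frequently_eq_zero isPreconnected_univ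
      (mem_univ z) hfreq
    exact F_ne_zero_abs (μ := κ) hx hF hFW (le_abs_self κ) (h0 (mem_univ _))
  · intro hκ
    ext μ
    simp only [mem_ofPred_eq, mem_empty_iff_false, iff_false]
    intro h
    have := hmem μ h
    have := abs_nonneg μ
    linarith
  · intro _ μ h
    exact abs_lt.1 (hmem μ h)
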